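/- For each σ ∈ {L,M,R}*M ∪ {L,M,R}*R there exists a suffix w of the finite word σ(0) such that, for every u ∈ {0,1}^ℕ with sup O(u) = sup₀(u), one has sup₀(σ(u)) = sup O(σ(u)) = w·σ(sup O(u)), where w·σ(sup O(u)) denotes the concatenation of the finite word w with the infinite word σ(sup O(u)). -/

import Mathlib

/-- `π_β(u)` for a binary sequence `u = u₁u₂⋯` (indexed from 0). -/
noncomputable def piB (β : ℝ) (u : ℕ → Bool) : ℝ :=
  ∑' k : ℕ, (if u k then (1 : ℝ) else 0) / β ^ (k + 1)

/-- `π_β(u)` for a real digit sequence. -/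
noncomputable def piR (β : ℝ) (u : ℕ → ℝ) : ℝ := ∑' k : ℕ, u k / β ^ (k + 1)

/-- A binary sequence viewed as a real digit sequence. -/
def bR (u : ℕ → Bool) : ℕ → ℝ := fun k => if u k then 1 else 0

/-- `U_β(A)`: sequences with digits in `A` whose `π_β`-value has no other expansion over `A`. -/
def Uset (β : ℝ) (A : Set ℝ) : Set (ℕ → ℝ) :=
  {u | (∀ k, u k ∈ A) ∧ ∀ v : ℕ → ℝ, (∀ k, v k ∈ A) → v ≠ u → piR β v ≠ piR β u}

/-- `𝓛(m) = inf {β > 1 : U_β(m) ∩ {0,1}^ℕ is uncountable}`. -/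
noncomputable def Lval (m : ℝ) : ℝ :=
  sInf {β : ℝ | 1 < β ∧ ¬ (Uset β {0, 1, m} ∩ {v | ∃ u : ℕ → Bool, v = bR u}).Countable}

/-- The shift orbit `O(u)` of an infinite binary word. -/
def orbit (u : ℕ → Bool) : Set (ℕ → Bool) := {v | ∃ k : ℕ, v = fun i => u (i + k)}

/-- Suffixes of `u` preceded by the letter `1`. -/
def orbit1 (u : ℕ → Bool) : Set (ℕ → Bool) :=
  {v | ∃ k : ℕ, u k = true ∧ v = fun i => u (i + k + 1)}

/-- Suffixes of `u` preceded by the letter `0`. -/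
def orbit0 (u : ℕ → Bool) : Set (ℕ → Bool) :=
  {v | ∃ k : ℕ, u k = false ∧ v = fun i => u (i + k + 1)}

open Classical in
/-- The lexicographic supremum of a set of binary sequences (greedy construction);
`⊥ = 0̄` for the empty set. -/
noncomputable def lexSupSeq (S : Set (ℕ → Bool)) : ℕ → Bool
  | n => decide (∃ u ∈ S, (∀ i, i < n → u i = lexSupSeq S i) ∧ u n = true)
  termination_by n => n

open Classical in
/-- The lexicographic infimum of a set of binary sequences (greedy construction);
`⊤ = 1̄` for the empty set. -/
noncomputable def lexInfSeq (S : Set (ℕ → Bool)) : ℕ → Bool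
  | n => decide (¬ ∃ u ∈ S, (∀ i, i < n → u i = lexInfSeq S i) ∧ u n = false)
  termination_by n => n

/-- `sup O(u)`, the lexicographically largest limit of suffixes of `u`. -/
noncomputable def supO (u : ℕ → Bool) : ℕ → Bool := lexSupSeq (orbit u)
/-- `inf O(u)`. -/
noncomputable def infO (u : ℕ → Bool) : ℕ → Bool := lexInfSeq (orbit u)
/-- `sup₀(u)`, the supremum of the suffixes preceded by `0`. -/
noncomputable def sup0 (u : ℕ → Bool) : ℕ → Bool := lexSupSeq (orbit0 u)
/-- `inf₁(u)`, the infimum of the suffixes preceded by `1`. -/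
noncomputable def inf1 (u : ℕ → Bool) : ℕ → Bool := lexInfSeq (orbit1 u)

/-- Strict lexicographic order on infinite binary words. -/
def lexLt (u v : ℕ → Bool) : Prop := ∃ n, (∀ i, i < n → u i = v i) ∧ u n < v n
/-- Lexicographic order on infinite binary words. -/
def lexLe (u v : ℕ → Bool) : Prop := lexLt u v ∨ u = v

/-- `f_u(m)`: the unique `β ≥ 1` with `β·π_β(sup O(u)) = m`. -/
noncomputable def fVal (u : ℕ → Bool) (m : ℝ) : ℝ :=
  sInf {β : ℝ | 1 ≤ β ∧ β * piB β (supO u) = m}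

/-- `g_u(m)`: the unique `β > 1` with `(β-1)(1+π_β(inf O(u))) = m`. -/
noncomputable def gVal (u : ℕ → Bool) (m : ℝ) : ℝ :=
  sInf {β : ℝ | 1 < β ∧ (β - 1) * (1 + piB β (infO u)) = m}

/-- `μ_u`: the unique `m ∈ (1,2]` with `f_u(m) = g_u(m)`. -/
noncomputable def muVal (u : ℕ → Bool) : ℝ :=
  sInf {m : ℝ | 1 < m ∧ m ≤ 2 ∧ fVal u m = gVal u m}

/-- `u` contains at least two ones. -/
def TwoOnes (u : ℕ → Bool) : Prop := ∃ k l, k < l ∧ u k = true ∧ u l = true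

/-- The substitution `L : 0 ↦ 0, 1 ↦ 01` (with `0 = false`, `1 = true`). -/
def Lsub : Bool → List Bool := fun b => if b then [false, true] else [false]
/-- The substitution `M : 0 ↦ 01, 1 ↦ 10`. -/
def Msub : Bool → List Bool := fun b => if b then [true, false] else [false, true]
/-- The substitution `R : 0 ↦ 01, 1 ↦ 1`. -/
def Rsub : Bool → List Bool := fun b => if b then [true] else [false, true]
/-- The identity substitution. -/
def idSub : Bool → List Bool := fun b => [b]
/-- Composition of substitutions: `compSub σ τ = σ ∘ τ` (apply `τ` first). -/
def compSub (σ τ : Bool → List Bool) : Bool → List Bool := fun b => (τ b).flatMap σ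

/-- The monoid `{L,M,R}*` generated by the three substitutions. -/
def LMRstar : Set (Bool → List Bool) :=
  {σ | ∃ l : List (Bool → List Bool),
    (∀ τ ∈ l, τ = Lsub ∨ τ = Msub ∨ τ = Rsub) ∧ σ = l.foldr compSub idSub}

/-- A substitution applied to an infinite word, `σ(u₁)σ(u₂)⋯`. -/
noncomputable def substApply (σ : Bool → List Bool) (u : ℕ → Bool) : ℕ → Bool := fun n =>
  let k := sSup {k : ℕ | (∑ i ∈ Finset.range k, (σ (u i)).length) ≤ n}
  (σ (u k)).getD (n - ∑ i ∈ Finset.range k, (σ (u i)).length) false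

/-- `u` is a limit word of the sequence of substitutions `σseq`. -/
def IsLimitWord (σseq : ℕ → Bool → List Bool) (u : ℕ → Bool) : Prop :=
  ∃ useq : ℕ → ℕ → Bool, useq 0 = u ∧ ∀ n, useq n = substApply (σseq n) (useq (n + 1))

/-- Primitivity of a sequence of substitutions in `{L,M,R}^ℕ`: no tail is constantly `L`
and no tail is constantly `R`. -/
def PrimitiveSeq (σseq : ℕ → Bool → List Bool) : Prop :=
  (¬ ∃ k, ∀ n, k ≤ n → σseq n = Lsub) ∧ ¬ ∃ k, ∀ n, k ≤ n → σseq n = Rsub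

/-- `S_{L,M,R}`: the set of limit words of primitive sequences of substitutions. -/
def Sset : Set (ℕ → Bool) :=
  {u | ∃ σseq : ℕ → Bool → List Bool,
    (∀ n, σseq n = Lsub ∨ σseq n = Msub ∨ σseq n = Rsub) ∧
    PrimitiveSeq σseq ∧ IsLimitWord σseq u}

/-- The word `1 0̄ = 1000⋯`. -/
def w10bar : ℕ → Bool := fun n => decide (n = 0)
/-- The word `0 1̄ = 0111⋯`. -/
def w01bar : ℕ → Bool := fun n => decide (n ≠ 0)
/-- The word `01 0̄ = 01000⋯`. -/
def w010bar : ℕ → Bool := fun n => decide (n = 1)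
/-- The word `10 1̄ = 10111⋯`. -/
def w101bar : ℕ → Bool := fun n => decide (n ≠ 1)
/-- The word `0̄`. -/
def w0bar : ℕ → Bool := fun _ => false
/-- The word `1̄`. -/
def w1bar : ℕ → Bool := fun _ => true

/-- Prepend a letter to an infinite word. -/
def consB (b : Bool) (u : ℕ → Bool) : ℕ → Bool := fun n =>
  match n with
  | 0 => b
  | Nat.succ k => u k

/-- Prepend a finite word to an infinite word. -/
def appendW (w : List Bool) (v : ℕ → Bool) : ℕ → Bool := fun n =>
  if n < w.length then w.getD n false else v (n - w.length)

/-- The word obtained by deleting the first `k` letters. -/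
def shiftW (k : ℕ) (u : ℕ → Bool) : ℕ → Bool := fun i => u (i + k)

/-- `u` and `v` agree on their first `n` letters. -/
def AgreeUpTo (n : ℕ) (u v : ℕ → Bool) : Prop := ∀ i, i < n → u i = v i

/-- If `u` and `v` agree on their first `n` letters, then the next letter of `u` is at most
that of `v`. -/
def LeAt (n : ℕ) (u v : ℕ → Bool) : Prop := AgreeUpTo n u v → u n ≤ v n

/-- A substitution mapping no letter to the empty word. -/
def NonErasing (σ : Bool → List Bool) : Prop := ∀ b, 0 < (σ b).length

theorem consB_head_tail (u : ℕ → Bool) : consB (u 0) (shiftW 1 u) = u := by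
  funext n
  cases n <;> rfl

theorem exists_eq_consB (u : ℕ → Bool) : ∃ b v, u = consB b v :=
  ⟨_, _, (consB_head_tail u).symm⟩

theorem consB_inj {a b : Bool} {u v : ℕ → Bool} (h : consB a u = consB b v) : a = b ∧ u = v :=
  ⟨congrFun h 0, funext fun n => congrFun h (n + 1)⟩

theorem shiftW_zero (u : ℕ → Bool) : shiftW 0 u = u := rfl

theorem shiftW_succ_consB (k : ℕ) (b : Bool) (u : ℕ → Bool) :
    shiftW (k + 1) (consB b u) = shiftW k u := rfl

theorem shiftW_shiftW (j k : ℕ) (u : ℕ → Bool) : shiftW j (shiftW k u) = shiftW (j + k) u := by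
  funext i
  simp [shiftW, add_assoc]

theorem shiftW_eq_consB (k : ℕ) (u : ℕ → Bool) :
    shiftW k u = consB (u k) (shiftW (k + 1) u) := by
  funext n
  cases n with
  | zero => simp [shiftW, consB]
  | succ n => simp only [shiftW, consB]; congr 1; omega

theorem appendW_nil (u : ℕ → Bool) : appendW [] u = u := by
  funext n
  simp [appendW]

theorem appendW_cons (b : Bool) (w : List Bool) (u : ℕ → Bool) :
    appendW (b :: w) u = consB b (appendW w u) := by
  funext n
  cases n <;> simp [appendW, consB]

theorem appendW_append (w x : List Bool) (u : ℕ → Bool) :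
    appendW (w ++ x) u = appendW w (appendW x u) := by
  induction w with
  | nil => simp [appendW_nil]
  | cons b w ih => simp [appendW_cons, ih]

theorem shiftW_appendW_of_le (w : List Bool) (u : ℕ → Bool) (n : ℕ) (h : n ≤ w.length) :
    shiftW n (appendW w u) = appendW (w.drop n) u := by
  induction w generalizing n with
  | nil => simp at h; subst h; simp [shiftW_zero]
  | cons b w ih =>
    cases n with
    | zero => simp [shiftW_zero]
    | succ n => simpa [appendW_cons, shiftW_succ_consB] using ih n (by simpa using h)

theorem shiftW_length_appendW (w : List Bool) (u : ℕ → Bool) :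
    shiftW w.length (appendW w u) = u := by
  rw [shiftW_appendW_of_le _ _ _ le_rfl]
  simp [appendW_nil]

theorem AgreeUpTo.mono {m n : ℕ} {u v : ℕ → Bool} (h : AgreeUpTo n u v) (hmn : m ≤ n) :
    AgreeUpTo m u v := fun i hi => h i (hi.trans_le hmn)

theorem agreeUpTo_consB_iff {n : ℕ} {a b : Bool} {u v : ℕ → Bool} :
    AgreeUpTo (n + 1) (consB a u) (consB b v) ↔ a = b ∧ AgreeUpTo n u v := by
  constructor
  · exact fun h => ⟨h 0 (by omega), fun i hi => h (i + 1) (by omega)⟩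
  · rintro ⟨h, h'⟩ (_ | i) hi
    · exact h
    · exact h' i (by omega)

theorem AgreeUpTo.appendW {n : ℕ} {u v : ℕ → Bool} (w : List Bool) (h : AgreeUpTo n u v) :
    AgreeUpTo (n + w.length) (appendW w u) (appendW w v) := by
  induction w with
  | nil => simpa [appendW_nil] using h
  | cons b w ih =>
    simp only [appendW_cons, List.length_cons, ← add_assoc]
    exact agreeUpTo_consB_iff.2 ⟨rfl, ih⟩

theorem leAt_zero_consB_iff {a b : Bool} {u v : ℕ → Bool} :
    LeAt 0 (consB a u) (consB b v) ↔ a ≤ b :=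
  ⟨fun h => h fun i hi => absurd hi (by omega), fun h _ => h⟩

theorem leAt_succ_consB_iff {n : ℕ} {a b : Bool} {u v : ℕ → Bool} :
    LeAt (n + 1) (consB a u) (consB b v) ↔ (a = b → LeAt n u v) := by
  unfold LeAt
  rw [agreeUpTo_consB_iff, and_imp]
  rfl

theorem leAt_false_true (n : ℕ) (u v : ℕ → Bool) :
    LeAt n (consB false u) (consB true v) := by
  cases n with
  | zero => simp [leAt_zero_consB_iff]
  | succ n => simp [leAt_succ_consB_iff]

theorem LeAt.consB {n : ℕ} {u v : ℕ → Bool} (b : Bool) (h : ∀ m ≤ n, LeAt m u v) :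
    LeAt n (consB b u) (consB b v) := by
  cases n with
  | zero => simp [leAt_zero_consB_iff]
  | succ n => simpa [leAt_succ_consB_iff] using h n (by omega)

theorem lexSupSeq_eq_true_iff (S : Set (ℕ → Bool)) (n : ℕ) :
    lexSupSeq S n = true ↔ ∃ u ∈ S, AgreeUpTo n u (lexSupSeq S) ∧ u n = true := by
  classical
  rw [lexSupSeq, decide_eq_true_iff]
  rfl

theorem lexSupSeq_eq {S : Set (ℕ → Bool)} {s : ℕ → Bool} (hle : ∀ v ∈ S, ∀ n, LeAt n v s)
    (happ : ∀ n, ∃ v ∈ S, AgreeUpTo n v s) : lexSupSeq S = s := by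
  funext n
  induction n using Nat.strong_induction_on with
  | _ n ih =>
    rw [Bool.eq_iff_iff, lexSupSeq_eq_true_iff]
    constructor
    · rintro ⟨v, hv, hag, hn⟩
      have := hle v hv n fun i hi => (hag i hi).trans (ih i hi)
      rw [hn] at this
      exact top_le_iff.1 this
    · intro hs
      obtain ⟨v, hv, hag⟩ := happ (n + 1)
      exact ⟨v, hv, fun i hi => (hag i (by omega)).trans (ih i hi).symm,
        (hag n (by omega)).trans hs⟩

theorem leAt_lexSupSeq {S : Set (ℕ → Bool)} {v : ℕ → Bool} (hv : v ∈ S) (n : ℕ) :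
    LeAt n v (lexSupSeq S) := by
  intro hag
  rw [Bool.le_iff_imp]
  intro hn
  rw [lexSupSeq_eq_true_iff]
  exact ⟨v, hv, hag, hn⟩

theorem exists_agreeUpTo_lexSupSeq {S : Set (ℕ → Bool)} (hS : S.Nonempty) (n : ℕ) :
    ∃ v ∈ S, AgreeUpTo n v (lexSupSeq S) := by
  induction n with
  | zero => exact ⟨hS.some, hS.some_mem, fun i hi => absurd hi (by omega)⟩
  | succ n ih =>
    have key : ∃ v ∈ S, AgreeUpTo n v (lexSupSeq S) ∧ v n = lexSupSeq S n := by
      cases hn : lexSupSeq S n with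
      | true =>
        exact (lexSupSeq_eq_true_iff S n).1 hn
      | false =>
        obtain ⟨v, hv, hag⟩ := ih
        refine ⟨v, hv, hag, ?_⟩
        have := leAt_lexSupSeq hv n hag
        rw [hn] at this
        exact le_bot_iff.1 this
    obtain ⟨v, hv, hag, hn⟩ := key
    refine ⟨v, hv, fun i hi => ?_⟩
    rcases Nat.lt_succ_iff_lt_or_eq.1 hi with h | rfl
    exacts [hag i h, hn]

theorem mem_orbit0_of_consB {u v : ℕ → Bool} {k : ℕ} (h : shiftW k u = consB false v) :
    v ∈ orbit0 u := by
  rw [shiftW_eq_consB] at h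
  exact ⟨k, (consB_inj h).1, (consB_inj h).2.symm⟩

theorem sup0_eq_and_supO_eq {u s : ℕ → Bool} (hle : ∀ v ∈ orbit u, ∀ n, LeAt n v s)
    (happ : ∀ n, ∃ v ∈ orbit0 u, AgreeUpTo n v s) : sup0 u = s ∧ supO u = s := by
  have hsub : orbit0 u ⊆ orbit u := by
    rintro v ⟨k, -, rfl⟩
    exact ⟨k + 1, rfl⟩
  exact ⟨lexSupSeq_eq (fun v hv => hle v (hsub hv)) happ,
    lexSupSeq_eq hle fun n => (happ n).imp fun _ => And.imp_left fun hv => hsub hv⟩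

theorem leAt_supO (u : ℕ → Bool) (k n : ℕ) : LeAt n (shiftW k u) (supO u) :=
  leAt_lexSupSeq (S := orbit u) ⟨k, rfl⟩ n

theorem exists_agreeUpTo_supO (u : ℕ → Bool) (n : ℕ) : ∃ k, AgreeUpTo n (shiftW k u) (supO u) := by
  obtain ⟨v, ⟨k, rfl⟩, h⟩ := exists_agreeUpTo_lexSupSeq (S := orbit u) ⟨u, 0, rfl⟩ n
  exact ⟨k, h⟩

theorem exists_agreeUpTo_sup0 {u : ℕ → Bool} (h : supO u = sup0 u) (n : ℕ) :
    ∃ k, u k = false ∧ AgreeUpTo n (shiftW (k + 1) u) (supO u) := by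
  have hne : (orbit0 u).Nonempty := by
    by_contra hempty
    rw [Set.not_nonempty_iff_eq_empty] at hempty
    have h0 : u 0 = true := by
      by_contra h0
      have : shiftW 1 u ∈ orbit0 u := ⟨0, by simpa using h0, rfl⟩
      simp [hempty] at this
    have h1 : sup0 u 0 = false := by
      rw [sup0, hempty, lexSupSeq]
      simp
    have h2 := leAt_supO u 0 0 fun i hi => absurd hi (by omega)
    rw [h, h1] at h2
    rw [shiftW_zero, h0] at h2
    exact absurd h2 (by decide)
  obtain ⟨v, ⟨k, hk, rfl⟩, hag⟩ := exists_agreeUpTo_lexSupSeq hne n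
  exact ⟨k, hk, h ▸ hag⟩

/-- The length of the image under `σ` of the first `k` letters of `u`. -/
def imageLength (σ : Bool → List Bool) (u : ℕ → Bool) (k : ℕ) : ℕ :=
  ∑ i ∈ Finset.range k, (σ (u i)).length

theorem imageLength_succ (σ : Bool → List Bool) (u : ℕ → Bool) (k : ℕ) :
    imageLength σ u (k + 1) = imageLength σ u k + (σ (u k)).length :=
  Finset.sum_range_succ _ _

theorem imageLength_consB_succ (σ : Bool → List Bool) (b : Bool) (u : ℕ → Bool) (k : ℕ) :
    imageLength σ (consB b u) (k + 1) = (σ b).length + imageLength σ u k := by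
  unfold imageLength
  rw [Finset.sum_range_succ', add_comm]
  rfl

theorem imageLength_mono (σ : Bool → List Bool) (u : ℕ → Bool) : Monotone (imageLength σ u) :=
  monotone_nat_of_le_succ fun k => by rw [imageLength_succ]; omega

theorem NonErasing.le_imageLength {σ : Bool → List Bool} (hσ : NonErasing σ) (u : ℕ → Bool)
    (k : ℕ) : k ≤ imageLength σ u k := by
  induction k with
  | zero => exact Nat.zero_le _
  | succ k ih => rw [imageLength_succ]; have := hσ (u k); omega

theorem substApply_imageLength_add (σ : Bool → List Bool) (u : ℕ → Bool) (k j : ℕ)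
    (hj : j < (σ (u k)).length) :
    substApply σ u (imageLength σ u k + j) = (σ (u k)).getD j false := by
  have hsup : sSup {m : ℕ | (∑ i ∈ Finset.range m, (σ (u i)).length) ≤ imageLength σ u k + j}
      = k := by
    refine IsGreatest.csSup_eq ⟨Nat.le_add_right _ _, fun m hm => ?_⟩
    by_contra hlt
    have h1 := imageLength_mono σ u (show k + 1 ≤ m by omega)
    rw [imageLength_succ] at h1
    have h2 : imageLength σ u m ≤ imageLength σ u k + j := hm
    omega
  unfold substApply
  simp only [hsup]
  congr 1
  exact Nat.add_sub_cancel_left _ _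

theorem NonErasing.exists_eq_imageLength_add {σ : Bool → List Bool} (hσ : NonErasing σ)
    (u : ℕ → Bool) (n : ℕ) : ∃ k j, j < (σ (u k)).length ∧ n = imageLength σ u k + j := by
  induction n with
  | zero => exact ⟨0, 0, hσ _, rfl⟩
  | succ n ih =>
    obtain ⟨k, j, hj, rfl⟩ := ih
    by_cases h : j + 1 < (σ (u k)).length
    · exact ⟨k, j + 1, h, rfl⟩
    · exact ⟨k + 1, 0, hσ _, by rw [imageLength_succ]; omega⟩

theorem NonErasing.substApply_consB {σ : Bool → List Bool} (hσ : NonErasing σ) (b : Bool)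
    (u : ℕ → Bool) : substApply σ (consB b u) = appendW (σ b) (substApply σ u) := by
  funext n
  by_cases hn : n < (σ b).length
  · have := substApply_imageLength_add σ (consB b u) 0 n hn
    rw [show imageLength σ (consB b u) 0 = 0 from rfl, zero_add] at this
    rw [this]
    simp [appendW, hn, consB]
  · obtain ⟨m, rfl⟩ := Nat.exists_eq_add_of_le (not_lt.1 hn)
    obtain ⟨k, j, hj, rfl⟩ := hσ.exists_eq_imageLength_add u m
    rw [← add_assoc, ← imageLength_consB_succ, substApply_imageLength_add σ (consB b u) (k + 1) j hj,
      imageLength_consB_succ, add_assoc]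
    simp only [appendW, if_neg (by omega : ¬ (σ b).length + (imageLength σ u k + j) < (σ b).length),
      Nat.add_sub_cancel_left]
    exact (substApply_imageLength_add σ u k j hj).symm

theorem NonErasing.substApply_appendW {σ : Bool → List Bool} (hσ : NonErasing σ) (w : List Bool)
    (u : ℕ → Bool) :
    substApply σ (appendW w u) = appendW (w.flatMap σ) (substApply σ u) := by
  induction w with
  | nil => simp [appendW_nil]
  | cons b w ih =>
    rw [appendW_cons, hσ.substApply_consB, ih, List.flatMap_cons, appendW_append]

theorem NonErasing.compSub {σ τ : Bool → List Bool} (hσ : NonErasing σ) (hτ : NonErasing τ) :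
    NonErasing (compSub σ τ) := by
  intro b
  have hb := hτ b
  unfold _root_.compSub
  cases h : τ b with
  | nil => simp [h] at hb
  | cons a w =>
    have := hσ a
    rw [List.flatMap_cons, List.length_append]
    omega

/-- A map on infinite words is determined by its effect on the first letter. -/
theorem NonErasing.eq_of_consB {ρ : Bool → List Bool} (hρ : NonErasing ρ)
    {F G : (ℕ → Bool) → ℕ → Bool} (hF : ∀ b u, F (consB b u) = appendW (ρ b) (F u))
    (hG : ∀ b u, G (consB b u) = appendW (ρ b) (G u)) : F = G := by
  have key : ∀ n u, AgreeUpTo n (F u) (G u) := by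
    intro n
    induction n with
    | zero => exact fun u i hi => absurd hi (by omega)
    | succ n ih =>
      intro u
      obtain ⟨b, v, rfl⟩ := exists_eq_consB u
      rw [hF, hG]
      have := hρ b
      exact ((ih v).appendW (ρ b)).mono (by omega)
  funext u n
  exact key (n + 1) u n (by omega)

theorem substApply_compSub {σ τ : Bool → List Bool} (hσ : NonErasing σ) (hτ : NonErasing τ)
    (u : ℕ → Bool) : substApply (compSub σ τ) u = substApply σ (substApply τ u) := by
  refine congrFun ((hσ.compSub hτ).eq_of_consB (F := substApply (compSub σ τ))
    (G := fun u => substApply σ (substApply τ u)) (hσ.compSub hτ).substApply_consB ?_) u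
  intro b u
  simp only [hτ.substApply_consB, hσ.substApply_appendW]
  rfl

theorem compSub_assoc (ρ σ τ : Bool → List Bool) :
    compSub (compSub ρ σ) τ = compSub ρ (compSub σ τ) := by
  funext b
  exact List.flatMap_assoc.symm

theorem idSub_compSub (τ : Bool → List Bool) : compSub idSub τ = τ := by
  funext b
  exact List.flatMap_singleton' _

theorem NonErasing.agreeUpTo_substApply {σ : Bool → List Bool} (hσ : NonErasing σ) {n : ℕ}
    {u v : ℕ → Bool} (h : AgreeUpTo n u v) : AgreeUpTo n (substApply σ u) (substApply σ v) := by
  induction n generalizing u v with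
  | zero => exact fun i hi => absurd hi (by omega)
  | succ n ih =>
    obtain ⟨a, u, rfl⟩ := exists_eq_consB u
    obtain ⟨b, v, rfl⟩ := exists_eq_consB v
    obtain ⟨rfl, htail⟩ := agreeUpTo_consB_iff.1 h
    rw [hσ.substApply_consB, hσ.substApply_consB]
    have := hσ a
    exact ((ih htail).appendW (σ a)).mono (by omega)

theorem NonErasing.exists_shiftW_substApply {σ : Bool → List Bool} (hσ : NonErasing σ)
    (u : ℕ → Bool) (k : ℕ) : ∃ p, shiftW p (substApply σ u) = substApply σ (shiftW k u) := by
  induction k with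
  | zero => exact ⟨0, rfl⟩
  | succ k ih =>
    obtain ⟨p, hp⟩ := ih
    refine ⟨(σ (u k)).length + p, ?_⟩
    rw [← shiftW_shiftW, hp, shiftW_eq_consB k, hσ.substApply_consB, shiftW_length_appendW]

theorem NonErasing.shiftW_substApply {σ : Bool → List Bool} (hσ : NonErasing σ)
    (u : ℕ → Bool) (n : ℕ) : ∃ k j, j < (σ (u k)).length ∧
      shiftW n (substApply σ u) = appendW ((σ (u k)).drop j) (substApply σ (shiftW (k + 1) u)) := by
  induction n with
  | zero =>
    refine ⟨0, 0, hσ _, ?_⟩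
    rw [List.drop_zero, ← hσ.substApply_consB, consB_head_tail]
    rfl
  | succ n ih =>
    obtain ⟨k, j, hj, h⟩ := ih
    rw [add_comm, ← shiftW_shiftW, h]
    rw [shiftW_appendW_of_le _ _ _ (by rw [List.length_drop]; omega), List.drop_drop]
    by_cases hj' : j + 1 < (σ (u k)).length
    · exact ⟨k, j + 1, hj', rfl⟩
    · refine ⟨k + 1, 0, hσ _, ?_⟩
      rw [List.drop_eq_nil_of_le (by omega), appendW_nil, List.drop_zero, ← hσ.substApply_consB,
        ← shiftW_eq_consB]

/-- A nonerasing substitution preserves the order if it does so on words with distinct first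
letters. -/
theorem NonErasing.leAt_substApply {σ : Bool → List Bool} (hσ : NonErasing σ)
    (hlt : ∀ n u v, LeAt n (substApply σ (consB false u)) (substApply σ (consB true v)))
    {u v : ℕ → Bool} (h : ∀ n, LeAt n u v) (n : ℕ) :
    LeAt n (substApply σ u) (substApply σ v) := by
  induction n using Nat.strong_induction_on generalizing u v with
  | _ n ih =>
    obtain ⟨a, u, rfl⟩ := exists_eq_consB u
    obtain ⟨b, v, rfl⟩ := exists_eq_consB v
    have hab := leAt_zero_consB_iff.1 (h 0)
    have htail := fun m => leAt_succ_consB_iff.1 (h (m + 1))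
    by_cases heq : a = b
    · subst heq
      rw [hσ.substApply_consB, hσ.substApply_consB]
      have happend : ∀ (w : List Bool) (m : ℕ), m < n + w.length →
          LeAt m (appendW w (substApply σ u)) (appendW w (substApply σ v)) := by
        intro w
        induction w with
        | nil =>
          intro m hm
          rw [appendW_nil, appendW_nil]
          exact ih m (by simpa using hm) fun m => htail m rfl
        | cons c w ihw =>
          intro m hm
          rw [appendW_cons, appendW_cons]
          cases m with
          | zero => simp [leAt_zero_consB_iff]
          | succ m =>
            rw [leAt_succ_consB_iff]
            exact fun _ => ihw m (by simp only [List.length_cons] at hm; omega)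
      exact happend _ n (by have := hσ a; omega)
    · obtain ⟨rfl, rfl⟩ : a = false ∧ b = true := Bool.lt_iff.1 (lt_of_le_of_ne hab heq)
      exact hlt n u v

theorem nonErasing_Lsub : NonErasing Lsub := by intro b; cases b <;> simp [Lsub]

theorem nonErasing_Msub : NonErasing Msub := by intro b; cases b <;> simp [Msub]

theorem nonErasing_Rsub : NonErasing Rsub := by intro b; cases b <;> simp [Rsub]

theorem Lsub_consB_false (u : ℕ → Bool) :
    substApply Lsub (consB false u) = consB false (substApply Lsub u) := by
  simp [nonErasing_Lsub.substApply_consB, Lsub, appendW_cons, appendW_nil]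

theorem Lsub_consB_true (u : ℕ → Bool) :
    substApply Lsub (consB true u) = consB false (consB true (substApply Lsub u)) := by
  simp [nonErasing_Lsub.substApply_consB, Lsub, appendW_cons, appendW_nil]

theorem Msub_consB_false (u : ℕ → Bool) :
    substApply Msub (consB false u) = consB false (consB true (substApply Msub u)) := by
  simp [nonErasing_Msub.substApply_consB, Msub, appendW_cons, appendW_nil]

theorem Msub_consB_true (u : ℕ → Bool) :
    substApply Msub (consB true u) = consB true (consB false (substApply Msub u)) := by
  simp [nonErasing_Msub.substApply_consB, Msub, appendW_cons, appendW_nil]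

theorem Rsub_consB_false (u : ℕ → Bool) :
    substApply Rsub (consB false u) = consB false (consB true (substApply Rsub u)) := by
  simp [nonErasing_Rsub.substApply_consB, Rsub, appendW_cons, appendW_nil]

theorem Rsub_consB_true (u : ℕ → Bool) :
    substApply Rsub (consB true u) = consB true (substApply Rsub u) := by
  simp [nonErasing_Rsub.substApply_consB, Rsub, appendW_cons, appendW_nil]

theorem exists_Lsub_eq_consB_false (u : ℕ → Bool) :
    ∃ v, substApply Lsub u = consB false v := by
  obtain ⟨b, u, rfl⟩ := exists_eq_consB u
  cases b
  exacts [⟨_, Lsub_consB_false u⟩, ⟨_, Lsub_consB_true u⟩]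

theorem leAt_Lsub {u v : ℕ → Bool} (h : ∀ n, LeAt n u v) (n : ℕ) :
    LeAt n (substApply Lsub u) (substApply Lsub v) := by
  refine nonErasing_Lsub.leAt_substApply (fun n u v => ?_) h n
  obtain ⟨x, hx⟩ := exists_Lsub_eq_consB_false u
  rw [Lsub_consB_false, Lsub_consB_true, hx]
  exact LeAt.consB _ fun m _ => leAt_false_true _ _ _

theorem leAt_Msub {u v : ℕ → Bool} (h : ∀ n, LeAt n u v) (n : ℕ) :
    LeAt n (substApply Msub u) (substApply Msub v) := by
  refine nonErasing_Msub.leAt_substApply (fun n u v => ?_) h n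
  rw [Msub_consB_false, Msub_consB_true]
  exact leAt_false_true _ _ _

theorem leAt_Rsub {u v : ℕ → Bool} (h : ∀ n, LeAt n u v) (n : ℕ) :
    LeAt n (substApply Rsub u) (substApply Rsub v) := by
  refine nonErasing_Rsub.leAt_substApply (fun n u v => ?_) h n
  rw [Rsub_consB_false, Rsub_consB_true]
  exact leAt_false_true _ _ _

/-- If `σ(0) = 01`, then `1·σ(sup₀(u))` is approximated by suffixes of `σ(u)` preceded by `0`. -/
theorem NonErasing.exists_mem_orbit0_agreeUpTo {σ : Bool → List Bool} (hσ : NonErasing σ)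
    (hσ0 : σ false = [false, true]) {u : ℕ → Bool} (h : supO u = sup0 u) (n : ℕ) :
    ∃ v ∈ orbit0 (substApply σ u), AgreeUpTo n v (consB true (substApply σ (supO u))) := by
  obtain ⟨k, hk, hag⟩ := exists_agreeUpTo_sup0 h n
  obtain ⟨p, hp⟩ := hσ.exists_shiftW_substApply u k
  rw [shiftW_eq_consB k, hk, hσ.substApply_consB, hσ0] at hp
  simp only [appendW_cons, appendW_nil] at hp
  exact ⟨_, mem_orbit0_of_consB hp,
    (agreeUpTo_consB_iff.2 ⟨rfl, hσ.agreeUpTo_substApply hag⟩).mono n.le_succ⟩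

theorem sup_Msub {u : ℕ → Bool} (h : supO u = sup0 u) :
    sup0 (substApply Msub u) = consB true (substApply Msub (supO u)) ∧
      supO (substApply Msub u) = consB true (substApply Msub (supO u)) := by
  refine sup0_eq_and_supO_eq ?_ (nonErasing_Msub.exists_mem_orbit0_agreeUpTo rfl h)
  rintro v ⟨p, rfl⟩ n
  obtain ⟨k, j, hj, hv⟩ := nonErasing_Msub.shiftW_substApply u p
  change LeAt n (shiftW p (substApply Msub u)) _
  rw [hv]
  cases hk : u k with
  | false =>
    rw [hk] at hj
    obtain rfl | rfl : j = 0 ∨ j = 1 := by simp [Msub] at hj; omega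
    · simp only [Msub, List.drop_zero, Bool.false_eq_true, if_false, appendW_cons]
      exact leAt_false_true _ _ _
    · simp only [Msub, List.drop_succ_cons, List.drop_zero, Bool.false_eq_true, if_false,
        appendW_cons, appendW_nil]
      exact LeAt.consB _ fun m _ => leAt_Msub (leAt_supO u (k + 1)) m
  | true =>
    rw [hk] at hj
    obtain rfl | rfl : j = 0 ∨ j = 1 := by simp [Msub] at hj; omega
    · have hle := leAt_supO u k 0
      obtain ⟨b, s, hs⟩ := exists_eq_consB (supO u)
      rw [shiftW_eq_consB, hk, hs, leAt_zero_consB_iff] at hle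
      obtain rfl : b = true := top_le_iff.1 hle
      simp only [Msub, List.drop_zero, if_true, appendW_cons]
      rw [hs, Msub_consB_true]
      exact LeAt.consB _ fun m _ => leAt_false_true _ _ _
    · simp only [Msub, List.drop_succ_cons, List.drop_zero, if_true, appendW_cons]
      exact leAt_false_true _ _ _

theorem sup_Rsub {u : ℕ → Bool} (h : supO u = sup0 u) :
    sup0 (substApply Rsub u) = consB true (substApply Rsub (supO u)) ∧
      supO (substApply Rsub u) = consB true (substApply Rsub (supO u)) := by
  refine sup0_eq_and_supO_eq ?_ (nonErasing_Rsub.exists_mem_orbit0_agreeUpTo rfl h)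
  rintro v ⟨p, rfl⟩ n
  obtain ⟨k, j, hj, hv⟩ := nonErasing_Rsub.shiftW_substApply u p
  change LeAt n (shiftW p (substApply Rsub u)) _
  rw [hv]
  cases hk : u k with
  | false =>
    rw [hk] at hj
    obtain rfl | rfl : j = 0 ∨ j = 1 := by simp [Rsub] at hj; omega
    · simp only [Rsub, List.drop_zero, Bool.false_eq_true, if_false, appendW_cons]
      exact leAt_false_true _ _ _
    · simp only [Rsub, List.drop_succ_cons, List.drop_zero, Bool.false_eq_true, if_false,
        appendW_cons, appendW_nil]
      exact LeAt.consB _ fun m _ => leAt_Rsub (leAt_supO u (k + 1)) m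
  | true =>
    rw [hk] at hj
    obtain rfl : j = 0 := by simpa [Rsub] using hj
    simp only [Rsub, List.drop_zero, if_true, appendW_cons, appendW_nil]
    exact LeAt.consB _ fun m _ => leAt_Rsub (leAt_supO u (k + 1)) m

theorem sup_Lsub {u s : ℕ → Bool} (hs : supO u = consB true s) :
    sup0 (substApply Lsub u) = consB true (substApply Lsub s) ∧
      supO (substApply Lsub u) = consB true (substApply Lsub s) := by
  refine sup0_eq_and_supO_eq ?_ fun n => ?_
  · rintro v ⟨p, rfl⟩ n
    obtain ⟨k, j, hj, hv⟩ := nonErasing_Lsub.shiftW_substApply u p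
    change LeAt n (shiftW p (substApply Lsub u)) _
    rw [hv]
    cases hk : u k with
    | false =>
      rw [hk] at hj
      obtain rfl : j = 0 := by simpa [Lsub] using hj
      simp only [Lsub, List.drop_zero, Bool.false_eq_true, if_false, appendW_cons]
      exact leAt_false_true _ _ _
    | true =>
      rw [hk] at hj
      obtain rfl | rfl : j = 0 ∨ j = 1 := by simp [Lsub] at hj; omega
      · simp only [Lsub, List.drop_zero, if_true, appendW_cons]
        exact leAt_false_true _ _ _
      · simp only [Lsub, List.drop_succ_cons, List.drop_zero, if_true, appendW_cons, appendW_nil]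
        refine LeAt.consB _ fun m _ => leAt_Lsub (fun i => ?_) m
        have hle := leAt_supO u k (i + 1)
        rw [hs, shiftW_eq_consB, hk, leAt_succ_consB_iff] at hle
        exact hle rfl
  · obtain ⟨k, hag⟩ := exists_agreeUpTo_supO u (n + 1)
    rw [hs, shiftW_eq_consB, agreeUpTo_consB_iff] at hag
    obtain ⟨p, hp⟩ := nonErasing_Lsub.exists_shiftW_substApply u k
    rw [shiftW_eq_consB k, hag.1, Lsub_consB_true] at hp
    exact ⟨_, mem_orbit0_of_consB hp,
      (agreeUpTo_consB_iff.2 ⟨rfl, nonErasing_Lsub.agreeUpTo_substApply hag.2⟩).mono n.le_succ⟩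

/-- The suffix `1x` of `σ(0)` is preceded by `0` and satisfies
`sup₀(σ(u)) = sup O(σ(u)) = 1x·σ(sup O(u))` whenever `sup O(u) = sup₀(u)`. -/
structure SupSuffix (σ : Bool → List Bool) (x : List Bool) : Prop where
  nonErasing : NonErasing σ
  suffix : (false :: true :: x) <:+ σ false
  sup : ∀ u : ℕ → Bool, supO u = sup0 u →
    sup0 (substApply σ u) = supO (substApply σ u) ∧
      supO (substApply σ u) = appendW (true :: x) (substApply σ (supO u))

theorem supSuffix_Msub : SupSuffix Msub [] where
  nonErasing := nonErasing_Msub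
  suffix := List.suffix_rfl
  sup u hu := by
    obtain ⟨h0, hO⟩ := sup_Msub hu
    exact ⟨h0.trans hO.symm, by rw [hO, appendW_cons, appendW_nil]⟩

theorem supSuffix_Rsub : SupSuffix Rsub [] where
  nonErasing := nonErasing_Rsub
  suffix := List.suffix_rfl
  sup u hu := by
    obtain ⟨h0, hO⟩ := sup_Rsub hu
    exact ⟨h0.trans hO.symm, by rw [hO, appendW_cons, appendW_nil]⟩

theorem List.IsSuffix.flatMap_right {α β : Type*} {l₁ l₂ : List α} (h : l₁ <:+ l₂)
    (f : α → List β) : l₁.flatMap f <:+ l₂.flatMap f := by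
  obtain ⟨t, rfl⟩ := h
  exact ⟨t.flatMap f, List.flatMap_append.symm⟩

/-- Composition on the left with a substitution `τ` such that `τ(0) = 01` and
`sup O(τ(u)) = 1·τ(sup O(u))`. -/
theorem SupSuffix.compSub_of_consB {σ τ : Bool → List Bool} {x : List Bool} (h : SupSuffix σ x)
    (hτ : NonErasing τ) (hτ0 : τ false = [false, true])
    (hsup : ∀ u, supO u = sup0 u →
      sup0 (substApply τ u) = consB true (substApply τ (supO u)) ∧
        supO (substApply τ u) = consB true (substApply τ (supO u))) :
    SupSuffix (compSub τ σ) ((true :: x).flatMap τ) where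
  nonErasing := hτ.compSub h.nonErasing
  suffix := by
    have := h.suffix.flatMap_right τ
    rw [List.flatMap_cons, hτ0] at this
    exact this
  sup u hu := by
    obtain ⟨h0, hO⟩ := h.sup u hu
    obtain ⟨h0', hO'⟩ := hsup _ h0.symm
    rw [substApply_compSub hτ h.nonErasing, substApply_compSub hτ h.nonErasing]
    exact ⟨h0'.trans hO'.symm, by rw [hO', hO, hτ.substApply_appendW, appendW_cons]⟩

theorem SupSuffix.compSub_Lsub {σ : Bool → List Bool} {x : List Bool} (h : SupSuffix σ x) :
    SupSuffix (compSub Lsub σ) (x.flatMap Lsub) where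
  nonErasing := nonErasing_Lsub.compSub h.nonErasing
  suffix := ((List.suffix_cons false _).trans h.suffix).flatMap_right Lsub
  sup u hu := by
    have hO := (h.sup u hu).2
    rw [appendW_cons] at hO
    obtain ⟨h0', hO'⟩ := sup_Lsub hO
    rw [substApply_compSub nonErasing_Lsub h.nonErasing,
      substApply_compSub nonErasing_Lsub h.nonErasing]
    exact ⟨h0'.trans hO'.symm, by rw [hO', nonErasing_Lsub.substApply_appendW, appendW_cons]⟩

theorem exists_supSuffix_compSub {τ ρ : Bool → List Bool} (hτ : τ ∈ LMRstar) {x : List Bool}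
    (hρ : SupSuffix ρ x) : ∃ y, SupSuffix (compSub τ ρ) y := by
  obtain ⟨l, hl, rfl⟩ := hτ
  induction l with
  | nil => exact ⟨x, by rwa [List.foldr_nil, idSub_compSub]⟩
  | cons τ l ih =>
    obtain ⟨y, hy⟩ := ih fun τ hτ => hl τ (List.mem_cons_of_mem _ hτ)
    rw [List.foldr_cons, compSub_assoc]
    rcases hl τ List.mem_cons_self with rfl | rfl | rfl
    · exact ⟨_, hy.compSub_Lsub⟩
    · exact ⟨_, hy.compSub_of_consB nonErasing_Msub rfl fun _ => sup_Msub⟩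
    · exact ⟨_, hy.compSub_of_consB nonErasing_Rsub rfl fun _ => sup_Rsub⟩

/-- For each `σ ∈ {L,M,R}*M ∪ {L,M,R}*R` there is a suffix `w` of `σ(0)` with
`sup₀(σ(u)) = sup O(σ(u)) = w·σ(sup O(u))` whenever `sup O(u) = sup₀(u)`. -/
theorem sup_subst_suffix (σ : Bool → List Bool)
    (hσ : (∃ τ ∈ LMRstar, σ = compSub τ Msub) ∨ ∃ τ ∈ LMRstar, σ = compSub τ Rsub) :
    ∃ w : List Bool, w <:+ σ false ∧
      ∀ u : ℕ → Bool, supO u = sup0 u →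
        sup0 (substApply σ u) = supO (substApply σ u) ∧
        supO (substApply σ u) = appendW w (substApply σ (supO u)) := by
  obtain ⟨x, hx⟩ : ∃ x, SupSuffix σ x := by
    rcases hσ with ⟨τ, hτ, rfl⟩ | ⟨τ, hτ, rfl⟩
    exacts [exists_supSuffix_compSub hτ supSuffix_Msub, exists_supSuffix_compSub hτ supSuffix_Rsub]
  exact ⟨true :: x, (List.suffix_cons false _).trans hx.suffix, hx.sup⟩
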